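/- For every d ≥ 3 there exists an infinite family (H_i)_{i ∈ ℕ} of finite simple graphs, each of maximum vertex degree d, such that for all i ≠ j there is no graph homomorphism from L(H_i) to L(H_j); that is, each interval [K_d, K_{d+1})_L of the homomorphism order of line graphs contains an infinite antichain. -/

import Mathlib

open SimpleGraph
namespace LG
inductive V (p e : ℕ) : Type
  | s (i : ZMod p) : V p e
  | u (i : ZMod p) : V p e
  | t (i : ZMod p) : V p e
  | w (i : ZMod p) (j : Fin 3) : V p e
  | a (i : ZMod p) (j : Fin 3) (x : Bool) (k : Fin (e+3)) : V p e

open V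

instance (p e : ℕ) [NeZero p] : Finite (V p e) := by
  let g : V p e → ZMod p × Option (Option (Option (Fin 3 ⊕ (Fin 3 × Bool × Fin (e+3))))) := fun v =>
    match v with
    | s i => (i, none)
    | u i => (i, some none)
    | t i => (i, some (some none))
    | w i j => (i, some (some (some (Sum.inl j))))
    | a i j x k => (i, some (some (some (Sum.inr (j, x, k)))))
  refine Finite.of_injective g ?_
  intro v v' h
  cases v <;> cases v' <;> simp_all [g]

def R {p e : ℕ} : V p e → V p e → Prop
  | s i, u i' => i = i' ∨ i = i' + 1
  | s i, w i' j => i = i' ∧ j = 0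
  | u i, t i' => i = i'
  | t i, w i' j => i = i' ∧ j ≠ 0
  | w i j, a i' j' _ k => i = i' ∧ j = j' ∧ k = 0
  | a i j x k, a i' j' x' k' => i = i' ∧ j = j' ∧ x ≠ x' ∧ ¬ (k = 0 ∧ k' = 0)
  | _, _ => False

def G (p e : ℕ) : SimpleGraph (V p e) where
  Adj v v' := R v v' ∨ R v' v
  symm := ⟨fun _ _ h => h.symm⟩
  loopless := ⟨fun v h => by cases v <;> simp [R] at h⟩

def nb {p e : ℕ} (i : ZMod p) (j : Fin 3) (x : Bool) (k k' : Fin (e+3)) : V p e :=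
  if k = 0 ∧ k' = 0 then w i j else a i j (!x) k'

lemma nbr_a {p e : ℕ} (i : ZMod p) (j : Fin 3) (x : Bool) (k : Fin (e+3)) :
    (G p e).neighborSet (a i j x k) = Set.range (nb i j x k) := by
  ext v
  simp only [mem_neighborSet, Set.mem_range, nb, G]
  constructor
  · intro h
    cases v with
    | s => simp [R] at h
    | u => simp [R] at h
    | t => simp [R] at h
    | w i' j' => simp [R] at h; exact ⟨0, by simp [h]⟩
    | a i' j' x' k' =>
      simp [R] at h
      refine ⟨k', ?_⟩
      have : (!x) = x' := by rcases h with h | h <;> cases x <;> cases x' <;> simp_all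
      grind
  · rintro ⟨k', rfl⟩
    split_ifs with h
    · simp [R, h]
    · left; simp [R]; grind

lemma ncard_a {p e : ℕ} (i : ZMod p) (j : Fin 3) (x : Bool) (k : Fin (e+3)) :
    ((G p e).neighborSet (a i j x k)).ncard = e + 3 := by
  rw [nbr_a, ← Set.image_univ, Set.ncard_image_of_injective, Set.ncard_univ, Nat.card_fin]
  intro k1 k2 h
  simp only [nb] at h
  split_ifs at h with h1 h2 h2
  · grind
  · simpa using h

lemma nbr_s {p e : ℕ} (i : ZMod p) (v : V p e) :
    (G p e).Adj (s i) v ↔ v = u i ∨ v = u (i-1) ∨ v = w i 0 := by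
  cases v <;> simp [G, R] <;> grind

lemma nbr_u {p e : ℕ} (i : ZMod p) (v : V p e) :
    (G p e).Adj (u i) v ↔ v = s i ∨ v = s (i+1) ∨ v = t i := by
  cases v <;> simp [G, R] <;> grind

lemma nbr_t {p e : ℕ} (i : ZMod p) (v : V p e) :
    (G p e).Adj (t i) v ↔ v = u i ∨ v = w i 1 ∨ v = w i 2 := by
  cases v <;> simp [G, R]
  · rename_i i' j'
    fin_cases j' <;> simp <;> grind

def cc {p e : ℕ} (i : ZMod p) (j : Fin 3) : V p e := if j = 0 then s i else t i

lemma nbr_w {p e : ℕ} (i : ZMod p) (j : Fin 3) (v : V p e) :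
    (G p e).Adj (w i j) v ↔ v = cc i j ∨ v = a i j false 0 ∨ v = a i j true 0 := by
  unfold cc
  split_ifs with h
  all_goals cases v <;> simp [G, R]
  all_goals grind

lemma ncard3 {α : Type*} (S : Set α) (x y z : α) (h : ∀ v ∈ S, v = x ∨ v = y ∨ v = z) :
    S.ncard ≤ 3 := by
  have : S ⊆ {x, y, z} := by intro v hv; simpa using h v hv
  refine (Set.ncard_le_ncard this (by simp)).trans ?_
  refine (Set.ncard_insert_le _ _).trans ?_
  have := Set.ncard_insert_le y {z}
  simp at this
  omega

lemma ncard_le {p e : ℕ} (v : V p e) : ((G p e).neighborSet v).ncard ≤ e + 3 := by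
  have H : ((G p e).neighborSet v).ncard ≤ 3 → ((G p e).neighborSet v).ncard ≤ e + 3 := by omega
  cases v with
  | s i => exact H (ncard3 _ _ _ _ fun v hv => (nbr_s i v).1 hv)
  | u i => exact H (ncard3 _ _ _ _ fun v hv => (nbr_u i v).1 hv)
  | t i => exact H (ncard3 _ _ _ _ fun v hv => (nbr_t i v).1 hv)
  | w i j => exact H (ncard3 _ _ _ _ fun v hv => (nbr_w i j v).1 hv)
  | a i j x k => exact (ncard_a i j x k).le

/-- three distinct neighbours -/
lemma three {p e : ℕ} (hp : 2 ≤ p) (v : V p e) : ∃ x y z, (G p e).Adj v x ∧ (G p e).Adj v y ∧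
    (G p e).Adj v z ∧ x ≠ y ∧ x ≠ z ∧ y ≠ z := by
  cases v with
  | s i =>
    refine ⟨u i, u (i-1), w i 0, ?_⟩
    have : Fact (1 < p) := ⟨hp⟩
    simp [nbr_s, eq_sub_iff_add_eq]
  | u i =>
    refine ⟨s i, s (i+1), t i, ?_⟩
    have : Fact (1 < p) := ⟨hp⟩
    simp [nbr_u]
  | t i => exact ⟨u i, w i 1, w i 2, by simp [nbr_t]⟩
  | w i j => exact ⟨cc i j, a i j false 0, a i j true 0, by simp [nbr_w]; unfold cc; split_ifs <;> simp⟩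
  | a i j x k =>
    have h := nbr_a i j x k
    have h2 : ∀ k', (G p e).Adj (a i j x k) (nb i j x k k') := fun k' => by
      rw [← mem_neighborSet, h]; simp
    refine ⟨_, _, _, h2 0, h2 1, h2 2, ?_⟩
    have h20 : (2 : Fin (e+3)) ≠ 0 := by
      rw [Ne, Fin.ext_iff]; simp [Nat.mod_eq_of_lt (show 2 < e + 3 by omega)]
    have h21 : (1 : Fin (e+3)) ≠ 2 := by
      rw [Ne, Fin.ext_iff]; simp [Nat.mod_eq_of_lt (show 2 < e + 3 by omega)]
    unfold nb
    simp [h20]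
    split_ifs <;> simp [h21]
    exact h20.symm

lemma trifree1 {p e : ℕ} (x y z : V p e) (hx : ∀ i j b k, x ≠ a i j b k) (h1 : (G p e).Adj x y)
    (h2 : (G p e).Adj y z) (h3 : (G p e).Adj x z) : False := by
  cases x with
  | s i =>
    rw [nbr_s] at h1 h3
    rcases h1 with rfl | rfl | rfl <;> rcases h3 with rfl | rfl | rfl <;> simp [G, R] at h2
  | u i =>
    rw [nbr_u] at h1 h3
    rcases h1 with rfl | rfl | rfl <;> rcases h3 with rfl | rfl | rfl <;> simp [G, R] at h2
  | t i =>
    rw [nbr_t] at h1 h3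
    rcases h1 with rfl | rfl | rfl <;> rcases h3 with rfl | rfl | rfl <;> simp [G, R] at h2
  | w i j =>
    rw [nbr_w] at h1 h3
    unfold cc at h1 h3
    rcases h1 with rfl | rfl | rfl <;> rcases h3 with rfl | rfl | rfl <;> (try split_ifs at h2) <;>
      simp [G, R] at h2
  | a i j b k => exact hx i j b k rfl

lemma trifree {p e : ℕ} (x y z : V p e) (h1 : (G p e).Adj x y)
    (h2 : (G p e).Adj y z) (h3 : (G p e).Adj x z) : False := by
  by_cases hx : ∀ i j b k, x ≠ a i j b k
  · exact trifree1 x y z hx h1 h2 h3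
  by_cases hy : ∀ i j b k, y ≠ a i j b k
  · exact trifree1 y z x hy h2 h3.symm h1.symm
  by_cases hz : ∀ i j b k, z ≠ a i j b k
  · exact trifree1 z x y hz h3.symm h1 h2.symm
  push Not at hx hy hz
  obtain ⟨i, j, b, k, rfl⟩ := hx
  obtain ⟨i, j, b', k, rfl⟩ := hy
  obtain ⟨i, j, b'', k, rfl⟩ := hz
  simp only [G, R] at h1 h2 h3
  have h1 : b ≠ b' := by grind
  have h2 : b' ≠ b'' := by grind
  have h3 : b ≠ b'' := by grind
  cases b <;> cases b' <;> cases b'' <;> simp_all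

/-- Vertex/dart description of a homomorphism of line graphs. -/
structure EM {V W : Type} (G : SimpleGraph V) (H : SimpleGraph W) where
  F : V → W
  N : V → V → W
  adj : ∀ {v v'}, G.Adj v v' → H.Adj (F v) (N v v')
  inj : ∀ {v v' v''}, G.Adj v v' → G.Adj v v'' → N v v' = N v v'' → v' = v''
  con : ∀ {v v'}, G.Adj v v' → (F v = F v' ∧ N v v' = N v' v) ∨ (F v' = N v v' ∧ N v' v = F v)

lemma exists_EM {V W : Type} (G : SimpleGraph V) (H : SimpleGraph W)
    (h3 : ∀ v, ∃ x y z, G.Adj v x ∧ G.Adj v y ∧ G.Adj v z ∧ x ≠ y ∧ x ≠ z ∧ y ≠ z)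
    (ht : ∀ x y z, H.Adj x y → H.Adj y z → H.Adj x z → False)
    (f : G.lineGraph →g H.lineGraph) : Nonempty (EM G H) := by
  classical
  let g : ∀ v v', G.Adj v v' → Sym2 W := fun v v' h => (f ⟨s(v, v'), h⟩ : Sym2 W)
  have gsymm : ∀ v v' (h : G.Adj v v'), g v v' h = g v' v h.symm := by
    intro v v' h
    simp only [g, Sym2.eq_swap]
  have gmem : ∀ v v' (h : G.Adj v v'), g v v' h ∈ H.edgeSet := fun v v' h => (f _).2
  have gadj : ∀ v v' v'' (h : G.Adj v v') (h' : G.Adj v v''), v' ≠ v'' →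
      g v v' h ≠ g v v'' h' ∧ ∃ x, x ∈ g v v' h ∧ x ∈ g v v'' h' := by
    intro v v' v'' h h' hne
    have : G.lineGraph.Adj ⟨s(v, v'), h⟩ ⟨s(v, v''), h'⟩ := by
      rw [lineGraph_adj_iff_exists]
      refine ⟨?_, v, by simp, by simp⟩
      intro h0
      have h1 := congrArg Subtype.val h0
      simp only [Sym2.eq_iff] at h1
      grind
    have := f.map_adj this
    rw [lineGraph_adj_iff_exists] at this
    refine ⟨?_, this.2⟩
    intro h0
    exact this.1 (Subtype.ext h0)
  have hF : ∀ v, ∃ x, ∀ v' (h : G.Adj v v'), x ∈ g v v' h := by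
    intro v
    obtain ⟨a, b, c, ha, hb, hc, hab, hac, hbc⟩ := h3 v
    -- any two distinct edges share exactly one vertex
    have key : ∀ a b c (ha : G.Adj v a) (hb : G.Adj v b) (hc : G.Adj v c), a ≠ b → a ≠ c → b ≠ c →
        ∀ x, x ∈ g v a ha → x ∈ g v b hb → x ∈ g v c hc := by
      intro a b c ha hb hc hab hac hbc x hxa hxb
      obtain ⟨y, hy⟩ := hxa
      obtain ⟨z, hz⟩ := hxb
      by_contra hx
      obtain ⟨h1, -⟩ := gadj v a b ha hb hab
      obtain ⟨-, y', h2, h2'⟩ := gadj v a c ha hc hac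
      obtain ⟨-, z', h3, h3'⟩ := gadj v b c hb hc hbc
      rw [hy] at h1 h2
      rw [hz] at h1 h3
      have e1 := gmem v a ha
      have e2 := gmem v b hb
      have e3 := gmem v c hc
      rw [hy] at e1
      rw [hz] at e2
      simp only [mem_edgeSet] at e1 e2
      have hy' : y' = y := by
        rcases Sym2.mem_iff.1 h2 with h | h
        · exact absurd (h ▸ h2') hx
        · exact h
      have hz' : z' = z := by
        rcases Sym2.mem_iff.1 h3 with h | h
        · exact absurd (h ▸ h3') hx
        · exact h
      subst hy' hz'
      have hne : y' ≠ z' := by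
        rintro rfl
        exact h1 rfl
      have := (Sym2.mem_and_mem_iff hne).1 ⟨h2', h3'⟩
      rw [this] at e3
      exact ht x y' z' e1 e3 e2
    obtain ⟨-, x, hxa, hxb⟩ := gadj v a b ha hb hab
    refine ⟨x, ?_⟩
    intro v' h
    by_cases h1 : v' = a
    · subst h1; exact hxa
    by_cases h2 : v' = b
    · subst h2; exact hxb
    exact key a b v' ha hb h hab (Ne.symm h1) (Ne.symm h2) x hxa hxb
  choose F hF using hF
  have hN : ∀ v v', ∃ y, ∀ (h : G.Adj v v'), g v v' h = s(F v, y) := by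
    intro v v'
    by_cases h : G.Adj v v'
    · obtain ⟨y, hy⟩ := hF v v' h
      exact ⟨y, fun _ => hy⟩
    · exact ⟨F v, fun h' => absurd h' h⟩
  choose N hN using hN
  refine ⟨⟨F, N, ?_, ?_, ?_⟩⟩
  · intro v v' h
    have := gmem v v' h
    rwa [hN] at this
  · intro v v' v'' h h' he
    by_contra hne
    apply (gadj v v' v'' h h' hne).1
    rw [hN, hN, he]
  · intro v v' h
    have := gsymm v v' h
    rw [hN, hN, Sym2.eq_iff] at this
    grind

/-- Parity lemma. -/
lemma parity {V W : Type} [DecidableEq V] [DecidableEq W] {G : SimpleGraph V} {H : SimpleGraph W}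
    (E : EM G H) (A : Finset V) (w : V)
    (hA : ∀ v ∈ A, ∀ v', G.Adj v v' → v' ∈ A ∨ v' = w) (hw : w ∉ A)
    (hs : ∀ v ∈ A, ∀ y, H.Adj (E.F v) y → ∃ v', G.Adj v v' ∧ E.N v v' = y)
    (x y : W) (hxy : H.Adj x y) (T : Finset V) 
    (hT : ∀ v, v ∈ T ↔ v ∈ A ∧ G.Adj w v ∧ s(E.F w, E.N w v) = s(x, y)) :
    Even ((A.filter (fun v => E.F v = x)).card + (A.filter (fun v => E.F v = y)).card + T.card) := by
  have esymm : ∀ v v', G.Adj v v' → s(E.F v, E.N v v') = s(E.F v', E.N v' v) := by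
    intro v v' h
    rw [Sym2.eq_iff]
    rcases E.con h with h | h <;> grind
  have einj : ∀ v v' v'', G.Adj v v' → G.Adj v v'' →
      s(E.F v, E.N v v') = s(E.F v, E.N v v'') → v' = v'' := by
    intro v v' v'' h h' he
    refine E.inj h h' ?_
    rw [Sym2.eq_iff] at he
    grind
  set S := A.filter (fun v => E.F v = x ∨ E.F v = y) with hS
  have hcard : (A.filter (fun v => E.F v = x)).card + (A.filter (fun v => E.F v = y)).card
      = S.card := by
    rw [hS, Finset.filter_or, Finset.card_union_of_disjoint]
    rw [Finset.disjoint_filter]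
    intro v _ h1 h2
    exact hxy.ne (h1.symm.trans h2)
  have hTS : T ⊆ S := by
    intro v hv
    obtain ⟨h1, h2, h3⟩ := (hT v).1 hv
    rw [esymm _ _ h2] at h3
    rw [hS, Finset.mem_filter]
    refine ⟨h1, ?_⟩
    rw [Sym2.eq_iff] at h3
    grind
  have hex : ∀ v ∈ S, ∃ v', G.Adj v v' ∧ s(E.F v, E.N v v') = s(x, y) := by
    intro v hv
    rw [hS, Finset.mem_filter] at hv
    obtain ⟨h1, h2 | h2⟩ := hv
    · obtain ⟨v', h3, h4⟩ := hs v h1 y (h2 ▸ hxy)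
      exact ⟨v', h3, by rw [h2, h4]⟩
    · obtain ⟨v', h3, h4⟩ := hs v h1 x (h2 ▸ hxy.symm)
      exact ⟨v', h3, by rw [h2, h4, Sym2.eq_swap]⟩
  choose! σ hσ1 hσ2 using hex
  have hev : Even (S \ T).card := by
    have h0 : ∑ v ∈ S \ T, (1 : ZMod 2) = 0 := by
      have hmem : ∀ v ∈ S \ T, σ v ∈ S \ T := by
        intro v hv
        rw [Finset.mem_sdiff] at hv
        obtain ⟨hv, hvT⟩ := hv
        have h1 := hσ1 v hv
        have h2 := hσ2 v hv
        have hvA : v ∈ A := (Finset.mem_filter.1 hv).1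
        have h3 := h2
        rw [esymm _ _ h1] at h3
        have hne : σ v ≠ w := by
          intro h
          rw [h] at h3 h1
          exact hvT ((hT v).2 ⟨hvA, h1.symm, h3⟩)
        have hσA : σ v ∈ A := (hA v hvA _ h1).resolve_right hne
        rw [Finset.mem_sdiff]
        constructor
        · rw [hS, Finset.mem_filter]
          refine ⟨hσA, ?_⟩
          rw [Sym2.eq_iff] at h3
          grind
        · intro h
          obtain ⟨-, h5, h6⟩ := (hT _).1 h
          rw [esymm _ _ h5] at h6
          have := einj _ _ _ h1.symm h5.symm (h3.trans h6.symm)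
          exact hw (this ▸ hvA)
      refine Finset.sum_involution (fun v _ => σ v) ?_ ?_ hmem ?_
      · intro v hv; decide
      · intro v hv _
        exact (hσ1 v (Finset.mem_sdiff.1 hv).1).ne'
      · intro v hv
        have hv1 := (Finset.mem_sdiff.1 hv).1
        have hv2 := (Finset.mem_sdiff.1 (hmem v hv)).1
        refine einj (σ v) _ _ (hσ1 _ hv2) (hσ1 v hv1).symm ?_
        rw [hσ2 _ hv2, ← esymm _ _ (hσ1 v hv1), hσ2 v hv1]
    rw [Finset.sum_const, nsmul_one] at h0
    exact (ZMod.natCast_eq_zero_iff_even).1 h0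
  rw [Finset.card_sdiff_of_subset hTS] at hev
  have := Finset.card_le_card hTS
  rw [hcard]
  have h2 : S.card + T.card = (S.card - T.card) + 2 * T.card := by omega
  rw [h2]
  exact hev.add (even_two_mul _)

end LG

namespace LG
open V

lemma blk_w {q e : ℕ} (Q : V q e → Prop) (x0 : V q e)
    (hQ : ∀ x y, (G q e).Adj x y → x ≠ x0 → y ≠ x0 → Q x → Q y) (i : ZMod q) (j : Fin 3)
    (hw : w i j ≠ x0) (ha : ∀ b k, a i j b k ≠ x0) (h : Q (w i j)) : ∀ b k, Q (a i j b k) := by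
  have h0 : ∀ b, Q (a i j b 0) := fun b => hQ _ _ (by simp [G, R]) hw (ha _ _) h
  intro b k
  by_cases hk : k = 0
  · subst hk; exact h0 b
  · exact hQ _ _ (by simp [G, R, hk]) (ha _ _) (ha _ _) (h0 (!b))

lemma blk_a {q e : ℕ} (Q : V q e → Prop) (x0 : V q e)
    (hQ : ∀ x y, (G q e).Adj x y → x ≠ x0 → y ≠ x0 → Q x → Q y) (i : ZMod q) (j : Fin 3)
    (hw : w i j ≠ x0) (b : Bool) (k : Fin (e+3)) (hz : a i j b k ≠ x0) (h : Q (a i j b k)) :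
    Q (w i j) := by
  have h0 : ∀ b, a i j b 0 ≠ x0 → Q (a i j b 0) → Q (w i j) := fun b hb hq =>
    hQ _ _ (by simp [G, R]) hb hw hq
  by_cases hk : k = 0
  · subst hk; exact h0 b hz h
  by_cases h1 : a i j (!b) 0 = x0
  · have h2 : ∀ k, a i j b k ≠ x0 := by rw [← h1]; simp
    have h3 : a i j (!b) 1 ≠ x0 := by rw [← h1]; simp
    have h4 : Q (a i j (!b) 1) := hQ _ _ (by simp [G, R]) hz h3 h
    exact h0 b (h2 0) (hQ _ _ (by simp [G, R]) h3 (h2 0) h4)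
  · exact h0 _ h1 (hQ _ _ (by simp [G, R, hk]) hz h1 h)

lemma blk_aw {q e : ℕ} (Q : V q e → Prop) (i : ZMod q) (j : Fin 3)
    (hQ : ∀ x y, (G q e).Adj x y → x ≠ w i j → y ≠ w i j → Q x → Q y) 
    (b : Bool) (k : Fin (e+3)) (h : Q (a i j b k)) : ∀ b k, Q (a i j b k) := by
  have st : ∀ b k k', (k ≠ 0 ∨ k' ≠ 0) → Q (a i j b k) → Q (a i j (!b) k') := fun b k k' hk hq =>
    hQ _ _ (by simp [G, R]; tauto) (by simp) (by simp) hq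
  have h1 : Q (a i j (!b) 1) := st _ _ _ (by simp) h
  have h2 : ∀ k, Q (a i j b k) := fun k => by simpa using st _ _ k (by simp) h1
  have h3 : ∀ k, Q (a i j (!b) k) := fun k => st _ _ k (by simp) (h2 1)
  intro b' k'
  by_cases hb : b' = b
  · subst hb; exact h2 k'
  · have : b' = !b := by cases b <;> cases b' <;> simp_all
    subst this; exact h3 k'

lemma closed {q e : ℕ} (Q : V q e → Prop) (x0 : V q e)
    (hQ : ∀ x y, (G q e).Adj x y → x ≠ x0 → y ≠ x0 → Q x → Q y)
    (z : V q e) (hz : z ≠ x0) (h : Q z) :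
    ∃ i j, (∀ b k, Q (a i j b k)) ∧ (x0 = w i j ∨ Q (w i j)) := by
  have W : ∀ i j, Q (w i j) → w i j ≠ x0 → (∀ b k, a i j b k ≠ x0) →
      ∃ i j, (∀ b k, Q (a i j b k)) ∧ (x0 = w i j ∨ Q (w i j)) := fun i j h1 h2 h3 =>
    ⟨i, j, blk_w Q x0 hQ i j h2 h3 h1, Or.inr h1⟩
  have T : ∀ i, Q (t i) → t i ≠ x0 → 
      ∃ i j, (∀ b k, Q (a i j b k)) ∧ (x0 = w i j ∨ Q (w i j)) := by
    intro i h1 h2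
    by_cases h3 : w i 1 ≠ x0 ∧ (∀ b k, a i 1 b k ≠ x0)
    · exact W i 1 (hQ _ _ (by simp [G, R]) h2 h3.1 h1) h3.1 h3.2
    · have h4 : w i 2 ≠ x0 ∧ (∀ b k, a i 2 b k ≠ x0) := by
        by_cases h5 : w i 1 = x0
        · rw [← h5]; simp
        · have : ∃ b k, a i 1 b k = x0 := by
            by_contra h6; push Not at h6; exact h3 ⟨h5, h6⟩
          obtain ⟨b, k, rfl⟩ := this
          simp
      exact W i 2 (hQ _ _ (by simp [G, R]) h2 h4.1 h1) h4.1 h4.2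
  have S : ∀ i, Q (s i) → s i ≠ x0 → 
      ∃ i j, (∀ b k, Q (a i j b k)) ∧ (x0 = w i j ∨ Q (w i j)) := by
    intro i h1 h2
    by_cases h3 : w i 0 ≠ x0 ∧ (∀ b k, a i 0 b k ≠ x0)
    · exact W i 0 (hQ _ _ (by simp [G, R]) h2 h3.1 h1) h3.1 h3.2
    · have h4 : u i ≠ x0 ∧ t i ≠ x0 := by
        by_cases h5 : w i 0 = x0
        · rw [← h5]; simp
        · have : ∃ b k, a i 0 b k = x0 := by
            by_contra h6; push Not at h6; exact h3 ⟨h5, h6⟩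
          obtain ⟨b, k, rfl⟩ := this
          simp
      have h5 : Q (u i) := hQ _ _ (by simp [G, R]) h2 h4.1 h1
      exact T i (hQ _ _ (by simp [G, R]) h4.1 h4.2 h5) h4.2
  have W' : ∀ i j, Q (w i j) → w i j ≠ x0 → 
      ∃ i j, (∀ b k, Q (a i j b k)) ∧ (x0 = w i j ∨ Q (w i j)) := by
    intro i j h1 h2
    by_cases h3 : ∀ b k, a i j b k ≠ x0
    · exact W i j h1 h2 h3
    push Not at h3
    obtain ⟨b, k, rfl⟩ := h3
    by_cases hj : j = 0
    · exact S i (hQ _ _ (by simp [G, R, hj]) h2 (by simp) h1) (by simp)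
    · exact T i (hQ _ _ (by simp [G, R, hj]) h2 (by simp) h1) (by simp)
  cases z with
  | s i => exact S i h hz
  | t i => exact T i h hz
  | u i =>
    by_cases h1 : t i = x0
    · exact S i (hQ _ _ (by simp [G, R]) hz (by rw [← h1]; simp) h) (by rw [← h1]; simp)
    · exact T i (hQ _ _ (by simp [G, R]) hz h1 h) h1
  | w i j => exact W' i j h hz
  | a i j b k =>
    by_cases h1 : w i j = x0
    · subst h1
      exact ⟨i, j, blk_aw Q i j hQ b k h, Or.inl rfl⟩
    · exact W' i j (blk_a Q x0 hQ i j h1 b k hz h) h1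

/-- blocks map to blocks -/
lemma block {p q e : ℕ} [NeZero q] (E : EM (G p e) (G q e)) (i : ZMod p) (j : Fin 3) :
    ∃ i' j', E.F (w i j) = w i' j' ∧ E.N (w i j) (cc i j) = cc i' j' := by
  classical
  let g : Bool × Fin (e+3) → V p e := fun x => a i j x.1 x.2
  have ginj : Function.Injective g := by
    rintro ⟨b, k⟩ ⟨b', k'⟩ h
    simpa [g] using h
  set A : Finset (V p e) := Finset.univ.image g with hAdef
  have memA : ∀ v, v ∈ A ↔ ∃ b k, v = a i j b k := by
    intro v
    simp [hAdef, g, eq_comm]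
  have cardA : A.card = 2 * (e + 3) := by
    rw [hAdef, Finset.card_image_of_injective _ ginj]; simp
  have hA : ∀ v ∈ A, ∀ v', (G p e).Adj v v' → v' ∈ A ∨ v' = w i j := by
    intro v hv v' h
    obtain ⟨b, k, rfl⟩ := (memA v).1 hv
    rw [← mem_neighborSet, nbr_a] at h
    obtain ⟨k', rfl⟩ := h
    unfold nb
    split_ifs
    · right; rfl
    · left; rw [memA]; exact ⟨_, _, rfl⟩
  have hw : w i j ∉ A := by simp [memA]
  have hs : ∀ v ∈ A, ∀ y, (G q e).Adj (E.F v) y → ∃ v', (G p e).Adj v v' ∧ E.N v v' = y := by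
    intro v hv y hy
    obtain ⟨b, k, rfl⟩ := (memA v).1 hv
    have h1 : E.N (a i j b k) '' ((G p e).neighborSet (a i j b k)) ⊆
        (G q e).neighborSet (E.F (a i j b k)) := by
      rintro _ ⟨v', h, rfl⟩
      exact E.adj h
    have h2 : (E.N (a i j b k) '' ((G p e).neighborSet (a i j b k))).ncard = e + 3 := by
      rw [Set.ncard_image_of_injOn, ncard_a]
      intro x hx y hy hxy
      exact E.inj hx hy hxy
    have h3 := Set.eq_of_subset_of_ncard_le h1 (by rw [h2]; exact ncard_le _) (Set.toFinite _)
    have h4 : y ∈ E.N (a i j b k) '' ((G p e).neighborSet (a i j b k)) := by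
      rw [h3]; exact hy
    exact h4
  have par := parity E A (w i j) hA hw hs
  set n : V q e → ℕ := fun x => (A.filter (fun v => E.F v = x)).card with hn
  let Q : V q e → Prop := fun x => Odd (n x)
  have aw : ∀ v, (G p e).Adj (w i j) v ↔ v = cc i j ∨ v = a i j false 0 ∨ v = a i j true 0 :=
    nbr_w i j
  have ccA : (cc i j : V p e) ∉ A := by
    rw [memA]; unfold cc; split_ifs <;> simp
  have adjc : (G p e).Adj (w i j) (cc i j) := (aw _).2 (by simp)
  have adja : ∀ b, (G p e).Adj (w i j) (a i j b 0) := fun b => by simp [G, R]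
  have eq1 : ∀ z v, (G p e).Adj (w i j) v → (G p e).Adj (w i j) z →
      s(E.F (w i j), E.N (w i j) v) = s(E.F (w i j), E.N (w i j) z) → v = z := by
    intro z v h1 h2 h
    refine E.inj h1 h2 ?_
    rw [Sym2.eq_iff] at h
    grind
  have hQ : ∀ x y, (G q e).Adj x y → x ≠ E.F (w i j) → y ≠ E.F (w i j) → Q x → Q y := by
    intro x y hxy hx hy hQx
    have := par x y hxy ∅ (by
      intro v
      simp only [Finset.notMem_empty, false_iff]
      rintro ⟨-, -, h⟩
      rw [Sym2.eq_iff] at h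
      grind)
    simp only [Q, hn] at hQx ⊢
    grind
  -- the parity along the two attaching edges
  have hodd : ∀ b, (Q (E.F (w i j)) ↔ ¬ Q (E.N (w i j) (a i j b 0))) := by
    intro b
    have := par _ _ (E.adj (adja b)) {a i j b 0} (by
      intro v
      rw [Finset.mem_singleton]
      constructor
      · rintro rfl
        exact ⟨(memA _).2 ⟨_, _, rfl⟩, adja b, rfl⟩
      · rintro ⟨-, h1, h2⟩
        exact eq1 _ _ h1 (adja b) h2)
    simp only [Q, hn]
    rw [Finset.card_singleton] at this
    grind
  have heven : (Q (E.F (w i j)) ↔ Q (E.N (w i j) (cc i j))) := by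
    have := par _ _ (E.adj adjc) ∅ (by
      intro v
      simp only [Finset.notMem_empty, false_iff]
      rintro ⟨hv, h1, h2⟩
      exact ccA (eq1 _ _ h1 adjc h2 ▸ hv))
    simp only [Q, hn]
    grind
  have hz : ∃ z, z ≠ E.F (w i j) ∧ Q z := by
    by_cases h : Q (E.F (w i j))
    · exact ⟨_, (E.adj adjc).ne', heven.1 h⟩
    · refine ⟨_, (E.adj (adja true)).ne', ?_⟩
      by_contra h2
      exact h ((hodd true).2 h2)
  obtain ⟨z, hz1, hz2⟩ := hz
  obtain ⟨i', j', h1, h2⟩ := closed Q _ hQ z hz1 hz2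
  -- counting
  have hcount : ∀ B : Finset (V q e), (∀ x ∈ B, Q x) → B.card ≤ 2 * (e+3) := by
    intro B hB
    rw [← cardA]
    refine (Finset.card_le_card ?_).trans (Finset.card_image_le (s := A) (f := E.F))
    intro x hx
    have : 0 < n x := (hB x hx).pos
    obtain ⟨v, hv⟩ := Finset.card_pos.1 this
    rw [Finset.mem_filter] at hv
    exact Finset.mem_image.2 ⟨v, hv.1, hv.2⟩
  let g' : Bool × Fin (e+3) → V q e := fun x => a i' j' x.1 x.2
  have ginj' : Function.Injective g' := by
    rintro ⟨b, k⟩ ⟨b', k'⟩ h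
    simpa [g'] using h
  set A' : Finset (V q e) := Finset.univ.image g' with hAdef'
  have cardA' : A'.card = 2 * (e + 3) := by
    rw [hAdef', Finset.card_image_of_injective _ ginj']; simp
  have memA' : ∀ v, v ∈ A' ↔ ∃ b k, v = a i' j' b k := by
    intro v
    simp [hAdef', g', eq_comm]
  have honly : ∀ x, Q x → x ∈ A' := by
    intro x hx
    by_contra hxA
    have := hcount (insert x A') (by
      intro y hy
      rw [Finset.mem_insert] at hy
      rcases hy with rfl | hy
      · exact hx
      · obtain ⟨b, k, rfl⟩ := (memA' _).1 hy
        exact h1 b k)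
    rw [Finset.card_insert_of_notMem hxA, cardA'] at this
    omega
  have hwQ : ¬ Q (w i' j') := fun h => by
    have := honly _ h
    simp [memA'] at this
  have hFw : E.F (w i j) = w i' j' := h2.resolve_right hwQ
  refine ⟨i', j', hFw, ?_⟩
  have h3 := E.adj adjc
  rw [hFw, nbr_w] at h3
  have h5 : ¬ Q (E.N (w i j) (cc i j)) := by
    rw [← heven, hFw]; exact hwQ
  rcases h3 with h3 | h3 | h3
  · exact h3
  · exact absurd (h3 ▸ h1 _ _) h5
  · exact absurd (h3 ▸ h1 _ _) h5

lemma final {p q e : ℕ} (hp : 2 ≤ p) (hq : 2 ≤ q) (E : EM (G p e) (G q e)) : q ∣ p := by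
  have : NeZero q := ⟨by omega⟩
  have : Fact (1 < q) := ⟨hq⟩
  have : Fact (1 < p) := ⟨hp⟩
  have hleaf : ∀ i j, ∃ i' j', (E.F (cc i j) = w i' j' ∧ E.N (cc i j) (w i j) = cc i' j') ∨ 
      (E.F (cc i j) = cc i' j' ∧ E.N (cc i j) (w i j) = w i' j') := by
    intro i j
    obtain ⟨i', j', h1, h2⟩ := block E i j
    refine ⟨i', j', ?_⟩
    have := E.con ((nbr_w i j (cc i j)).2 (by simp))
    grind
  -- t maps to t
  have ht : ∀ i, ∃ k, E.F (t i) = t k ∧ E.N (t i) (u i) = u k := by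
    intro i
    have a1 : (G p e).Adj (t i) (w i 1) := by simp [nbr_t]
    have a2 : (G p e).Adj (t i) (w i 2) := by simp [nbr_t]
    have a3 : (G p e).Adj (t i) (u i) := by simp [nbr_t]
    have n1 : E.N (t i) (w i 1) ≠ E.N (t i) (w i 2) := fun h => by simpa using E.inj a1 a2 h
    have n2 : E.N (t i) (w i 1) ≠ E.N (t i) (u i) := fun h => by simpa using E.inj a1 a3 h
    have n3 : E.N (t i) (w i 2) ≠ E.N (t i) (u i) := fun h => by simpa using E.inj a2 a3 h
    obtain ⟨i1, j1, h1⟩ := hleaf i 1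
    obtain ⟨i2, j2, h2⟩ := hleaf i 2
    have b3 := E.adj a3
    have c1 : (cc i 1 : V p e) = t i := by simp [cc]
    have c2 : (cc i 2 : V p e) = t i := by simp [cc]
    rw [c1] at h1
    rw [c2] at h2
    have d1 : ∀ (i : ZMod q) j, (cc i j : V q e) = s i ∧ j = 0 ∨ (cc i j : V q e) = t i ∧ j ≠ 0 := by
      intro i j; unfold cc; split_ifs <;> simp_all
    have e1 := d1 i1 j1
    have e2 := d1 i2 j2
    have hk : E.F (t i) = t i1 := by grind
    refine ⟨i1, hk, ?_⟩
    rw [hk, nbr_t] at b3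
    have f1 := E.adj a1
    have f2 := E.adj a2
    rw [hk, nbr_t] at f1 f2
    grind
  have hs : ∀ i, ∃ k j, (E.F (s i) = w k j ∧ E.N (s i) (w i 0) = cc k j) ∨ 
      (E.F (s i) = cc k j ∧ E.N (s i) (w i 0) = w k j) := by
    intro i
    simpa [cc] using hleaf i 0
  have hu0 : ∀ i, ∃ k, (E.F (u i) = t k ∧ E.N (u i) (t i) = u k) ∨
      (E.F (u i) = u k ∧ E.N (u i) (t i) = t k) := by
    intro i
    obtain ⟨k, h1, h2⟩ := ht i
    refine ⟨k, ?_⟩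
    have := E.con (show (G p e).Adj (t i) (u i) by simp [nbr_t])
    grind
  have as1 : ∀ i, (G p e).Adj (s i) (u i) := fun i => by simp [nbr_s]
  have as2 : ∀ i, (G p e).Adj (s (i+1)) (u i) := fun i => by simp [nbr_s]
  have as3 : ∀ i, (G p e).Adj (s i) (w i 0) := fun i => by simp [nbr_s]
  have au : ∀ i, (G p e).Adj (u i) (t i) := fun i => by simp [nbr_u]
  have ns : ∀ i, E.N (s (i+1)) (u (i+1)) ≠ E.N (s (i+1)) (u i) := fun i h => by
    simpa using E.inj (as1 _) (as2 _) h
  have ns1 : ∀ i, E.N (s i) (u i) ≠ E.N (s i) (w i 0) := fun i h => by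
    simpa using E.inj (as1 _) (as3 _) h
  have ns2 : ∀ i, E.N (s (i+1)) (u i) ≠ E.N (s (i+1)) (w (i+1) 0) := fun i h => by
    simpa using E.inj (as2 _) (as3 _) h
  have nu : ∀ i, E.N (u i) (s i) ≠ E.N (u i) (s (i+1)) := fun i h => by
    simpa using E.inj (as1 _).symm (as2 _).symm h
  have nu1 : ∀ i, E.N (u i) (s i) ≠ E.N (u i) (t i) := fun i h => by
    simpa using E.inj (as1 _).symm (au _) h
  have nu2 : ∀ i, E.N (u i) (s (i+1)) ≠ E.N (u i) (t i) := fun i h => by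
    simpa using E.inj (as2 _).symm (au _) h
  have hu : ∀ i, ∃ k, E.F (u i) = u k ∧ E.N (u i) (t i) = t k := by
    intro i
    obtain ⟨k, h | h⟩ := hu0 i
    · exfalso
      obtain ⟨h1, h2⟩ := h
      have b := E.adj (as2 i).symm
      rw [h1, nbr_t] at b
      have b2 := nu2 i
      rw [h2] at b2
      have hj : ∃ j, j ≠ 0 ∧ E.N (u i) (s (i+1)) = w k j := by
        rcases b with b | b | b
        · exact absurd b b2
        · exact ⟨1, by simp, b⟩
        · exact ⟨2, by simp, b⟩
      obtain ⟨j, hj0, hj⟩ := hj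
      have hc := E.con (as2 i)
      rw [h1, hj] at hc
      obtain ⟨k', j', h3⟩ := hs (i+1)
      have m2 := ns2 i
      have e1 : (cc k' j' : V q e) = s k' ∧ j' = 0 ∨ (cc k' j' : V q e) = t k' ∧ j' ≠ 0 := by
        unfold cc; split_ifs <;> simp_all
      have e2 : (cc k j : V q e) = t k := by simp [cc, hj0]
      have hF : E.F (s (i+1)) = t k ∧ E.N (s (i+1)) (u i) = w k j ∧
          E.N (s (i+1)) (w (i+1) 0) = w k j' ∧ j' ≠ 0 := by
        grind
      obtain ⟨g1, g2, g3, g4⟩ := hF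
      have b4 := E.adj (as1 (i+1))
      rw [g1, nbr_t] at b4
      have m1 := ns1 (i+1)
      have m0 := ns i
      rw [g3] at m1 m2
      rw [g2] at m0 m2
      have hN : E.N (s (i+1)) (u (i+1)) = u k := by
        rcases b4 with b4 | b4 | b4
        · exact b4
        · exfalso; rw [b4] at m1 m0; simp at m0 m1 m2; omega
        · exfalso; rw [b4] at m1 m0; simp at m0 m1 m2; omega
      have hc2 := E.con (as1 (i+1))
      rw [g1, hN] at hc2
      obtain ⟨k2, h5⟩ := hu0 (i+1)
      have m4 := nu1 (i+1)
      grind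
    · exact ⟨k, h⟩
  choose κ hκ1 hκ2 using hu
  have hsu : ∀ i, E.F (s i) = E.N (u i) (s i) ∧ E.N (s i) (u i) = u (κ i) := by
    intro i
    have hc := E.con (as1 i).symm
    obtain ⟨k', j', h3⟩ := hs i
    have e1 : (cc k' j' : V q e) = s k' ∧ j' = 0 ∨ (cc k' j' : V q e) = t k' ∧ j' ≠ 0 := by
      unfold cc; split_ifs <;> simp_all
    have := hκ1 i
    grind
  have hsu' : ∀ i, E.F (s (i+1)) = E.N (u i) (s (i+1)) ∧ E.N (s (i+1)) (u i) = u (κ i) := by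
    intro i
    have hc := E.con (as2 i).symm
    obtain ⟨k', j', h3⟩ := hs (i+1)
    have e1 : (cc k' j' : V q e) = s k' ∧ j' = 0 ∨ (cc k' j' : V q e) = t k' ∧ j' ≠ 0 := by
      unfold cc; split_ifs <;> simp_all
    have := hκ1 i
    grind
  have hσ : ∀ i, ∃ m, E.F (s i) = s m ∧ (m = κ i ∨ m = κ i + 1) := by
    intro i
    have h1 := E.adj (as1 i).symm
    rw [hκ1, nbr_u] at h1
    have h2 := nu1 i
    rw [hκ2] at h2
    rw [(hsu i).1]
    grind
  choose σ hσ1 hσ2 using hσ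
  have hne : ∀ i, κ (i+1) ≠ κ i := by
    intro i h
    apply ns i
    rw [(hsu _).2, (hsu' i).2, h]
  have hne' : ∀ i, σ (i+1) ≠ σ i := by
    intro i h
    apply nu i
    rw [← (hsu i).1, ← (hsu' i).1, hσ1, hσ1, h]
  have hσ3 : ∀ i, σ (i+1) = κ i ∨ σ (i+1) = κ i + 1 := by
    intro i
    have h1 := E.adj (as2 i).symm
    rw [hκ1, nbr_u, ← (hsu' i).1, hσ1] at h1
    simpa using h1
  have step : ∀ i, (σ i = κ i → σ (i+1) = σ i + 1 ∧ σ (i+1) = κ (i+1)) ∧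
      (σ i = κ i + 1 → σ (i+1) = σ i - 1 ∧ σ (i+1) = κ (i+1) + 1) := by
    intro i
    have h1 := hσ3 i
    have h2 := hσ2 (i+1)
    have h3 := hne i
    have h4 := hne' i
    grind
  rcases hσ2 0 with h0 | h0
  · have H : ∀ n : ℕ, σ (n : ZMod p) = σ 0 + n ∧ σ (n : ZMod p) = κ n := by
      intro n
      induction n with
      | zero => simpa using h0
      | succ n ih =>
        have := (step n).1 ih.2
        push_cast
        refine ⟨?_, this.2⟩
        rw [this.1, ih.1]; ring
    have := (H p).1
    rw [ZMod.natCast_self] at this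
    rw [← ZMod.natCast_eq_zero_iff]
    simpa using this
  · have H : ∀ n : ℕ, σ (n : ZMod p) = σ 0 - n ∧ σ (n : ZMod p) = κ n + 1 := by
      intro n
      induction n with
      | zero => simpa using h0
      | succ n ih =>
        have := (step n).2 ih.2
        push_cast
        refine ⟨?_, this.2⟩
        rw [this.1, ih.1]; ring
    have := (H p).1
    rw [ZMod.natCast_self] at this
    rw [← ZMod.natCast_eq_zero_iff]
    linear_combination this

end LG

theorem lineGraph_interval_infinite_antichain (d : ℕ) (hd : 3 ≤ d) :
    ∃ (V : ℕ → Type) (_ : ∀ i, Fintype (V i)) (H : ∀ i, SimpleGraph (V i)),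
      (∀ i, (∀ v, ((H i).neighborSet v).ncard ≤ d) ∧
        ∃ v, ((H i).neighborSet v).ncard = d) ∧
      (∀ i j : ℕ, i ≠ j → IsEmpty ((H i).lineGraph →g (H j).lineGraph)) := by
  obtain ⟨e, rfl⟩ : ∃ e, d = e + 3 := ⟨d - 3, by omega⟩
  have hP : ∀ i, (Nat.nth Nat.Prime i).Prime := fun i => Nat.prime_nth_prime i
  have hNZ : ∀ i, NeZero (Nat.nth Nat.Prime i) := fun i => ⟨(hP i).ne_zero⟩
  refine ⟨fun i => LG.V (Nat.nth Nat.Prime i) e, fun i => Fintype.ofFinite _,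
    fun i => LG.G (Nat.nth Nat.Prime i) e, ?_, ?_⟩
  · intro i
    exact ⟨LG.ncard_le, LG.V.a 0 0 true 0, LG.ncard_a _ _ _ _⟩
  · intro i j hij
    constructor
    intro f
    obtain ⟨E⟩ := LG.exists_EM _ _ (LG.three (hP i).two_le) LG.trifree f
    have h := LG.final (hP i).two_le (hP j).two_le E
    rw [Nat.prime_dvd_prime_iff_eq (hP j) (hP i)] at h
    exact hij (Nat.nth_injective Nat.infinite_setOf_prime h).symm
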